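/- Let z : [0,1] × (0,T] → ℝ satisfy: for each u ∈ [0,1] the function z(u,·) is continuous on (0,T]; for each t ∈ (0,T] the function u ↦ z(u,t) is nondecreasing and right-continuous with left limits; and for every φ in a dense subset H of the space of continuous compactly supported functions on ℝ (with the supremum norm), ∫₀¹ φ(z(u,t)) du → ∫₀¹ φ(u) du as t → 0+. Then for every u ∈ (0,1), lim_{t→0+} z(u,t) = u. -/

import Mathlib

open MeasureTheory Set Filter Topology

/-- The composition of a continuous compactly supported function with a function that is monotone
on `[0, 1]` is interval integrable on `[0, 1]`. -/
theorem intervalIntegrable_comp_of_monotoneOn {f w : ℝ → ℝ} (hf : Continuous f)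
    (hfc : HasCompactSupport f) (hw : MonotoneOn w (Icc 0 1)) :
    IntervalIntegrable (fun u => f (w u)) volume 0 1 := by
  obtain ⟨C, hC⟩ := hf.bounded_above_of_compact_support hfc
  rw [intervalIntegrable_iff_integrableOn_Icc_of_le zero_le_one]
  have hm : AEMeasurable w (volume.restrict (Icc 0 1)) :=
    aemeasurable_restrict_of_monotoneOn measurableSet_Icc hw
  exact Integrable.of_bound (hf.measurable.comp_aemeasurable hm).aestronglyMeasurable C
    (Eventually.of_forall fun u => hC (w u))

/-- If `|f - φ| ≤ ε` pointwise, the integrals of `f ∘ w` and `φ ∘ w` over `[0, 1]` differ by at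
most `ε`. -/
theorem abs_integral_comp_sub_le {f φ w : ℝ → ℝ} {ε : ℝ} (hf : Continuous f)
    (hfc : HasCompactSupport f) (hφ : Continuous φ) (hφc : HasCompactSupport φ)
    (hw : MonotoneOn w (Icc 0 1)) (h : ∀ x, |f x - φ x| ≤ ε) :
    |(∫ u in (0 : ℝ)..1, f (w u)) - ∫ u in (0 : ℝ)..1, φ (w u)| ≤ ε := by
  rw [← intervalIntegral.integral_sub (intervalIntegrable_comp_of_monotoneOn hf hfc hw)
    (intervalIntegrable_comp_of_monotoneOn hφ hφc hw)]
  simpa using intervalIntegral.norm_integral_le_of_norm_le_const (a := 0) (b := 1)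
    (f := fun u => f (w u) - φ (w u)) fun u _ => h (w u)

/-- Convergence of `∫₀¹ φ (z u t) du` to `∫₀¹ φ` extends from a dense set of test functions to all
continuous compactly supported functions. -/
theorem tendsto_integral_comp_of_dense {l : Filter ℝ} {z : ℝ → ℝ → ℝ}
    (hmono : ∀ᶠ t in l, MonotoneOn (fun u => z u t) (Icc 0 1)) {H : Set (ℝ → ℝ)}
    (hH : ∀ φ ∈ H, Continuous φ ∧ HasCompactSupport φ)
    (hdense : ∀ f : ℝ → ℝ, Continuous f → HasCompactSupport f →
      ∀ ε > (0 : ℝ), ∃ φ ∈ H, ∀ x : ℝ, |f x - φ x| ≤ ε)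
    (hconv : ∀ φ ∈ H, Tendsto (fun t => ∫ u in (0 : ℝ)..1, φ (z u t)) l
      (𝓝 (∫ u in (0 : ℝ)..1, φ u)))
    {f : ℝ → ℝ} (hf : Continuous f) (hfc : HasCompactSupport f) :
    Tendsto (fun t => ∫ u in (0 : ℝ)..1, f (z u t)) l (𝓝 (∫ u in (0 : ℝ)..1, f u)) := by
  rw [Metric.tendsto_nhds]
  intro ε hε
  obtain ⟨φ, hφH, hφ⟩ := hdense f hf hfc (ε / 4) (by positivity)
  obtain ⟨hφ1, hφ2⟩ := hH φ hφH
  have h0 := abs_le.1 (abs_integral_comp_sub_le hf hfc hφ1 hφ2 (monotone_id.monotoneOn _) hφ)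
  filter_upwards [hmono, Metric.tendsto_nhds.1 (hconv φ hφH) (ε / 4) (by positivity)]
    with t ht hd
  have h1 := abs_le.1 (abs_integral_comp_sub_le hf hfc hφ1 hφ2 ht hφ)
  rw [Real.dist_eq, abs_lt] at hd ⊢
  simp only [id] at h0
  constructor <;> linarith [h0.1, h0.2, h1.1, h1.2, hd.1, hd.2]

/-- A function bounded by `1` that vanishes on `[0, 1] \ [c, d]` has integral at most `d - c` over
`[0, 1]`. -/
theorem integral_le_sub_of_eq_zero {g : ℝ → ℝ} {c d : ℝ} (hcd : c ≤ d)
    (hg : IntervalIntegrable g volume 0 1) (h1 : ∀ x, g x ≤ 1)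
    (h0 : ∀ x ∈ Icc 0 1, x ∉ Icc c d → g x = 0) :
    ∫ x in (0 : ℝ)..1, g x ≤ d - c := by
  have hle : ∀ x ∈ Icc (0 : ℝ) 1, g x ≤ (Icc c d).indicator (fun _ => (1 : ℝ)) x := by
    intro x hx
    by_cases hxc : x ∈ Icc c d
    · simpa [indicator_of_mem hxc] using h1 x
    · simp [indicator_of_notMem hxc, h0 x hx hxc]
  have hint : Integrable ((Icc c d).indicator fun _ => (1 : ℝ)) volume :=
    (integrable_indicator_iff measurableSet_Icc).2 (by simp)
  calc ∫ x in (0 : ℝ)..1, g x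
      ≤ ∫ x in (0 : ℝ)..1, (Icc c d).indicator (fun _ => (1 : ℝ)) x :=
        intervalIntegral.integral_mono_on zero_le_one hg hint.intervalIntegrable hle
    _ = ∫ x in Ioc (0 : ℝ) 1, (Icc c d).indicator (fun _ => (1 : ℝ)) x :=
        intervalIntegral.integral_of_le zero_le_one
    _ ≤ ∫ x, (Icc c d).indicator (fun _ => (1 : ℝ)) x :=
        setIntegral_le_integral hint
          (Eventually.of_forall (indicator_nonneg fun _ _ => zero_le_one))
    _ = d - c := by
        rw [integral_indicator measurableSet_Icc]
        simp [hcd]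

/-- A nonnegative continuous function equal to `1` on `[c, d] ⊆ [0, 1]` has integral at least
`d - c` over `[0, 1]`. -/
theorem sub_le_integral_of_eq_one {f : ℝ → ℝ} {c d : ℝ} (hc : 0 ≤ c) (hcd : c ≤ d) (hd : d ≤ 1)
    (hf : Continuous f) (h0 : ∀ x, 0 ≤ f x) (h1 : ∀ x ∈ Icc c d, f x = 1) :
    d - c ≤ ∫ x in (0 : ℝ)..1, f x := by
  have e : ∫ x in c..d, f x = d - c := by
    rw [intervalIntegral.integral_congr (g := fun _ => 1)
      (fun x hx => h1 x (by rwa [uIcc_of_le hcd] at hx))]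
    simp
  rw [← e]
  exact intervalIntegral.integral_mono_interval hc hcd hd (Eventually.of_forall h0)
    (hf.intervalIntegrable 0 1)

/-- let `z : [0,1] × (0,T] → ℝ` be continuous in `t` for each `u`,
nondecreasing and right-continuous with left limits in `u` for each `t`, and suppose that
`∫₀¹ φ(z(u,t)) du → ∫₀¹ φ(u) du` as `t → 0+` for every `φ` in a dense subset `H` of the
continuous compactly supported functions on `ℝ` (with the supremum norm). Then
`z(u,t) → u` as `t → 0+` for every `u ∈ (0,1)`. -/
theorem pointwise_limit_at_zero (T : ℝ) (hT : 0 < T) (z : ℝ → ℝ → ℝ)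
    (hcont : ∀ u ∈ Set.Icc (0 : ℝ) 1, ContinuousOn (fun t => z u t) (Set.Ioc 0 T))
    (hmono : ∀ t ∈ Set.Ioc (0 : ℝ) T, MonotoneOn (fun u => z u t) (Set.Icc 0 1))
    (hrc : ∀ t ∈ Set.Ioc (0 : ℝ) T, ∀ u ∈ Set.Ico (0 : ℝ) 1,
      Tendsto (fun v => z v t) (𝓝[Set.Ioi u ∩ Set.Icc 0 1] u) (𝓝 (z u t)))
    (hll : ∀ t ∈ Set.Ioc (0 : ℝ) T, ∀ u ∈ Set.Ioc (0 : ℝ) 1,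
      ∃ L : ℝ, Tendsto (fun v => z v t) (𝓝[Set.Iio u ∩ Set.Icc 0 1] u) (𝓝 L))
    (H : Set (ℝ → ℝ))
    (hH : ∀ φ ∈ H, Continuous φ ∧ HasCompactSupport φ)
    (hdense : ∀ f : ℝ → ℝ, Continuous f → HasCompactSupport f →
      ∀ ε > (0 : ℝ), ∃ φ ∈ H, ∀ x : ℝ, |f x - φ x| ≤ ε)
    (hconv : ∀ φ ∈ H, Tendsto (fun t => ∫ u in (0 : ℝ)..1, φ (z u t))
      (𝓝[Set.Ioc 0 T] 0) (𝓝 (∫ u in (0 : ℝ)..1, φ u))) :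
    ∀ u ∈ Set.Ioo (0 : ℝ) 1, Tendsto (fun t => z u t) (𝓝[Set.Ioc 0 T] 0) (𝓝 u) := by
  intro u hu
  have hmem : ∀ᶠ t in 𝓝[Set.Ioc 0 T] (0 : ℝ), t ∈ Set.Ioc 0 T := self_mem_nhdsWithin
  have hmono' : ∀ᶠ t in 𝓝[Set.Ioc 0 T] (0 : ℝ), MonotoneOn (fun u => z u t) (Icc 0 1) :=
    hmem.mono hmono
  have huI : u ∈ Icc (0 : ℝ) 1 := Ioo_subset_Icc_self hu
  refine tendsto_order.2 ⟨fun a ha => ?_, fun a ha => ?_⟩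
  · obtain ⟨b, hb, hbu⟩ := exists_between (max_lt ha hu.1)
    obtain ⟨hab, hb0⟩ := max_lt_iff.1 hb
    obtain ⟨f, hf1, hf0, hfc, hf⟩ := exists_continuous_one_zero_of_isCompact
      (isCompact_Icc (a := b) (b := 1)) (isClosed_Iic (a := a))
      (Set.disjoint_left.2 fun x hx hxa => absurd (hx.1.trans hxa) hab.not_ge)
    have hlim := tendsto_integral_comp_of_dense hmono' hH hdense hconv f.continuous hfc
    have hge := sub_le_integral_of_eq_one hb0.le (hbu.trans hu.2).le le_rfl f.continuous
      (fun x => (hf x).1) hf1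
    filter_upwards [hmono', hlim.eventually_const_lt
      (show 1 - u < ∫ x in (0 : ℝ)..1, f x by linarith)] with t ht hlt
    by_contra! hza
    refine hlt.not_ge (integral_le_sub_of_eq_zero hu.2.le
      (intervalIntegrable_comp_of_monotoneOn f.continuous hfc ht) (fun x => (hf _).2)
      fun x hx hxu => hf0 ?_)
    have hxu' : x ≤ u := le_of_not_ge fun h => hxu ⟨h, hx.2⟩
    exact (ht hx huI hxu').trans hza
  · obtain ⟨b, hbu, hb⟩ := exists_between (lt_min ha hu.2)
    obtain ⟨hba, hb1⟩ := lt_min_iff.1 hb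
    obtain ⟨f, hf1, hf0, hfc, hf⟩ := exists_continuous_one_zero_of_isCompact
      (isCompact_Icc (a := 0) (b := b)) (isClosed_Ici (a := a))
      (Set.disjoint_left.2 fun x hx hxa => absurd (le_trans hxa hx.2) hba.not_ge)
    have hlim := tendsto_integral_comp_of_dense hmono' hH hdense hconv f.continuous hfc
    have hge := sub_le_integral_of_eq_one le_rfl (hu.1.trans hbu).le hb1.le f.continuous
      (fun x => (hf x).1) hf1
    filter_upwards [hmono', hlim.eventually_const_lt
      (show u - 0 < ∫ x in (0 : ℝ)..1, f x by linarith)] with t ht hlt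
    by_contra! hza
    refine hlt.not_ge (integral_le_sub_of_eq_zero hu.1.le
      (intervalIntegrable_comp_of_monotoneOn f.continuous hfc ht) (fun x => (hf _).2)
      fun x hx hxu => hf0 ?_)
    have hxu' : u ≤ x := le_of_not_ge fun h => hxu ⟨hx.1, h⟩
    exact hza.trans (ht huI hx hxu')
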